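/- For any finite graph G with at least one edge, σ(G) is the smallest positive integer k such that the number of maximal intersecting families of subsets of [k] is at least χ(G). -/

import Mathlib

open SimpleGraph

/-- `o` is an orientation of the simple graph `G`: every oriented pair is an edge of `G`,
and every edge `{x,y}` of `G` receives exactly one of the two directions. -/
def IsOrientation {V : Type*} (G : SimpleGraph V) (o : V → V → Prop) : Prop :=
  (∀ x y, o x y → G.Adj x y) ∧ ∀ x y, G.Adj x y → (o x y ↔ ¬ o y x)

/-- The list of orientations `o 1, …, o k` of `G` is an orientation covering of `G`:
each `o i` is an orientation of `G`, and whenever `xy, xz ∈ E(G)` there is some `i`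
in which both `xy` and `xz` are oriented away from `x`. -/
def IsOrientationCovering {V : Type*} (G : SimpleGraph V) {k : ℕ}
    (o : Fin k → V → V → Prop) : Prop :=
  (∀ i, IsOrientation G (o i)) ∧
    ∀ x y z, G.Adj x y → G.Adj x z → ∃ i, o i x y ∧ o i x z

/-- The orientation covering number `σ(G)`: the smallest positive `k` for which there
exist `k` orientations of `G` forming an orientation covering of `G`. -/
noncomputable def orCov {V : Type*} (G : SimpleGraph V) : ℕ :=
  sInf {k : ℕ | 0 < k ∧ ∃ o : Fin k → V → V → Prop, IsOrientationCovering G o}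

/-- A family `𝒜` of subsets of `[k]` is intersecting if any two of its members meet. -/
def IntersectingFam {k : ℕ} (𝒜 : Finset (Finset (Fin k))) : Prop :=
  ∀ S ∈ 𝒜, ∀ T ∈ 𝒜, (S ∩ T).Nonempty

/-- A family `𝒜` of subsets of `[k]` is maximal intersecting if it is intersecting and is
not properly contained in any intersecting family of subsets of `[k]`. -/
def MaxIntersectingFam {k : ℕ} (𝒜 : Finset (Finset (Fin k))) : Prop :=
  IntersectingFam 𝒜 ∧ ∀ ℬ : Finset (Finset (Fin k)), IntersectingFam ℬ → 𝒜 ⊆ ℬ → ℬ = 𝒜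

/-- `λ(k)`: the number of maximal intersecting families of subsets of `[k]`. -/
noncomputable def lambdaMI (k : ℕ) : ℕ :=
  Nat.card {𝒜 : Finset (Finset (Fin k)) // MaxIntersectingFam 𝒜}

/-- Every intersecting family is contained in a maximal one. -/
theorem IntersectingFam.exists_maxIntersectingFam {k : ℕ} {𝒜 : Finset (Finset (Fin k))}
    (h : IntersectingFam 𝒜) : ∃ ℬ, 𝒜 ⊆ ℬ ∧ MaxIntersectingFam ℬ := by
  obtain ⟨ℬ, hle, hmax⟩ := (Set.toFinite {𝒞 | IntersectingFam 𝒞}).exists_le_maximal h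
  exact ⟨ℬ, hle, hmax.prop, fun 𝒞 h𝒞 hsub => (hmax.eq_of_le h𝒞 hsub).symm⟩

/-- A set that meets itself and every member of a maximal intersecting family belongs to it. -/
theorem MaxIntersectingFam.mem_of_forall_inter_nonempty {k : ℕ} {𝒜 : Finset (Finset (Fin k))}
    (h : MaxIntersectingFam 𝒜) {S : Finset (Fin k)} (hS : S.Nonempty)
    (hST : ∀ T ∈ 𝒜, (S ∩ T).Nonempty) : S ∈ 𝒜 := by
  rw [← h.2 (insert S 𝒜) _ (Finset.subset_insert S 𝒜)]
  · exact Finset.mem_insert_self S 𝒜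
  · intro A hA B hB
    rcases Finset.mem_insert.1 hA with rfl | hA𝒜 <;>
      rcases Finset.mem_insert.1 hB with rfl | hB𝒜
    · simpa using hS
    · exact hST B hB𝒜
    · rw [Finset.inter_comm]
      exact hST A hA𝒜
    · exact h.1 A hA𝒜 B hB𝒜

/-- Maximal intersecting families are closed under taking supersets. -/
theorem MaxIntersectingFam.mem_of_subset {k : ℕ} {𝒜 : Finset (Finset (Fin k))}
    (h : MaxIntersectingFam 𝒜) {S T : Finset (Fin k)} (hS : S ∈ 𝒜) (hST : S ⊆ T) : T ∈ 𝒜 := by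
  refine h.mem_of_forall_inter_nonempty ?_
    fun U hU => (h.1 S hS U hU).mono (Finset.inter_subset_inter_right hST)
  have hne := h.1 S hS S hS
  rw [Finset.inter_self] at hne
  exact hne.mono hST

/-- Distinct maximal intersecting families are separated by a set and its complement. -/
theorem MaxIntersectingFam.exists_mem_compl_mem {k : ℕ} {𝒜 ℬ : Finset (Finset (Fin k))}
    (h𝒜 : MaxIntersectingFam 𝒜) (hℬ : MaxIntersectingFam ℬ) (hne : 𝒜 ≠ ℬ) :
    ∃ S ∈ 𝒜, Sᶜ ∈ ℬ := by
  by_contra! hcon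
  have hmeet : ∀ S ∈ 𝒜, ∀ T ∈ ℬ, (S ∩ T).Nonempty := by
    intro S hS T hT
    rw [← Finset.not_disjoint_iff_nonempty_inter]
    intro hd
    exact hcon S hS (hℬ.mem_of_subset hT (Finset.subset_compl_iff_disjoint_left.2 hd))
  have hunion : IntersectingFam (𝒜 ∪ ℬ) := by
    intro S hS T hT
    rcases Finset.mem_union.1 hS with hS | hS <;> rcases Finset.mem_union.1 hT with hT | hT
    · exact h𝒜.1 S hS T hT
    · exact hmeet S hS T hT
    · rw [Finset.inter_comm]
      exact hmeet T hT S hS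
    · exact hℬ.1 S hS T hT
  exact hne ((h𝒜.2 _ hunion Finset.subset_union_left).symm.trans
    (hℬ.2 _ hunion Finset.subset_union_right))

/-- The family of all sets containing a fixed element is maximal intersecting. -/
theorem maxIntersectingFam_filter_mem {k : ℕ} (i : Fin k) :
    MaxIntersectingFam (Finset.univ.filter fun S : Finset (Fin k) => i ∈ S) := by
  refine ⟨fun S hS T hT => ⟨i, by simp_all⟩, fun ℬ hℬ hsub => ?_⟩
  refine Finset.Subset.antisymm (fun S hS => ?_) hsub
  obtain ⟨j, hj⟩ := hℬ S hS {i} (hsub (by simp))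
  simp only [Finset.mem_inter, Finset.mem_singleton] at hj
  simpa [← hj.2] using hj.1

theorem le_lambdaMI (k : ℕ) : k ≤ lambdaMI k := by
  let f : Fin k → {𝒜 : Finset (Finset (Fin k)) // MaxIntersectingFam 𝒜} :=
    fun i => ⟨_, maxIntersectingFam_filter_mem i⟩
  have hf : Function.Injective f := by
    intro i j hij
    have hmem : ({i} : Finset (Fin k)) ∈ (f j).1 := by
      rw [← hij]
      simp [f]
    exact (by simpa [f] using hmem : j = i).symm
  simpa [lambdaMI] using Nat.card_le_card_of_injective f hf

/-- A graph with an orientation covering of size `k` is `λ(k)`-colorable. -/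
theorem IsOrientationCovering.colorable {V : Type*} {G : SimpleGraph V} {k : ℕ}
    {o : Fin k → V → V → Prop} (ho : IsOrientationCovering G o) : G.Colorable (lambdaMI k) := by
  classical
  let out : V → V → Finset (Fin k) := fun x y => Finset.univ.filter fun i => o i x y
  have hint : ∀ x, IntersectingFam (Finset.univ.filter fun S => ∃ y, G.Adj x y ∧ out x y = S) := by
    intro x S hS T hT
    obtain ⟨y, hxy, rfl⟩ := (Finset.mem_filter.1 hS).2
    obtain ⟨z, hxz, rfl⟩ := (Finset.mem_filter.1 hT).2
    obtain ⟨i, hi⟩ := ho.2 x y z hxy hxz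
    exact ⟨i, by simpa [out] using hi⟩
  choose ℳ hsub hmax using fun x => (hint x).exists_maxIntersectingFam
  have hmem : ∀ x y, G.Adj x y → out x y ∈ ℳ x := fun x y hxy =>
    hsub x (Finset.mem_filter.2 ⟨Finset.mem_univ _, y, hxy, rfl⟩)
  let C : G.Coloring {𝒜 : Finset (Finset (Fin k)) // MaxIntersectingFam 𝒜} :=
    Coloring.mk (fun x => ⟨ℳ x, hmax x⟩) fun {x y} hxy heq => by
      have hℳ : ℳ x = ℳ y := congrArg Subtype.val heq
      obtain ⟨i, hi⟩ := (hmax y).1 _ (hℳ ▸ hmem x y hxy) _ (hmem y x hxy.symm)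
      simp only [out, Finset.mem_inter, Finset.mem_filter, Finset.mem_univ, true_and] at hi
      exact ((ho.1 i).2 x y hxy).1 hi.1 hi.2
  have : Fintype {𝒜 : Finset (Finset (Fin k)) // MaxIntersectingFam 𝒜} := Fintype.ofFinite _
  rw [lambdaMI, Nat.card_eq_fintype_card]
  exact C.colorable

/-- A `λ(k)`-colorable graph has an orientation covering of size `k`. -/
theorem exists_isOrientationCovering_of_colorable {V : Type*} {G : SimpleGraph V} {k : ℕ}
    (h : G.Colorable (lambdaMI k)) :
    ∃ o : Fin k → V → V → Prop, IsOrientationCovering G o := by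
  obtain ⟨C⟩ := h
  let e := (Finite.equivFin {𝒜 : Finset (Finset (Fin k)) // MaxIntersectingFam 𝒜}).symm
  have hsep : ∀ a b, ∃ S, a ≠ b → S ∈ (e a).1 ∧ Sᶜ ∈ (e b).1 := by
    intro a b
    by_cases hab : a = b
    · exact ⟨∅, fun hne => absurd hab hne⟩
    · obtain ⟨S, hS⟩ := (e a).2.exists_mem_compl_mem (e b).2
        fun heq => hab (e.injective (Subtype.ext heq))
      exact ⟨S, fun _ => hS⟩
  choose S hS using hsep
  let T := fun a b => if a < b then S a b else (S b a)ᶜ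
  have hT : ∀ a b, a ≠ b → T a b ∈ (e a).1 := by
    intro a b hab
    by_cases hlt : a < b
    · simpa [T, hlt] using (hS a b hab).1
    · simpa [T, hlt] using (hS b a hab.symm).2
  have hcompl : ∀ a b, a ≠ b → T a b = (T b a)ᶜ := by
    intro a b hab
    rcases lt_or_gt_of_ne hab with hlt | hlt <;> simp [T, hlt, hlt.not_gt]
  refine ⟨fun i x y => G.Adj x y ∧ i ∈ T (C x) (C y), fun i => ⟨fun x y hxy => hxy.1, ?_⟩, ?_⟩
  · intro x y hxy
    simp [hxy, hxy.symm, hcompl _ _ (C.valid hxy)]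
  · intro x y z hxy hxz
    obtain ⟨i, hi⟩ := (e (C x)).2.1 _ (hT _ _ (C.valid hxy)) _ (hT _ _ (C.valid hxz))
    exact ⟨i, ⟨hxy, (Finset.mem_inter.1 hi).1⟩, hxz, (Finset.mem_inter.1 hi).2⟩

/-- For any finite graph `G` with at least one edge, `σ(G)` is the smallest positive
integer `k` such that the number of maximal intersecting families of subsets of `[k]`
is at least `χ(G)`. -/
theorem orCov_isLeast_lambda_ge_chromaticNumber
    {V : Type*} [Fintype V] (G : SimpleGraph V) (hG : ∃ u v, G.Adj u v)
    (n : ℕ) (hn : G.chromaticNumber = (n : ℕ∞)) :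
    IsLeast {k : ℕ | 0 < k ∧ n ≤ lambdaMI k} (orCov G) := by
  have hiff : ∀ k, (∃ o : Fin k → V → V → Prop, IsOrientationCovering G o) ↔ n ≤ lambdaMI k := by
    intro k
    rw [← Nat.cast_le (α := ℕ∞), ← hn, chromaticNumber_le_iff_colorable]
    exact ⟨fun ⟨_, ho⟩ => ho.colorable, exists_isOrientationCovering_of_colorable⟩
  simp only [orCov, hiff]
  exact ⟨Nat.sInf_mem ⟨n + 1, n.succ_pos, n.le_succ.trans (le_lambdaMI _)⟩,
    fun k hk => Nat.sInf_le hk⟩
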